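/- For every r ∈ (0, 1) and every Lebesgue measurable set A ⊆ [-1, 1-2r] with m(A) > 0, one has μ_{[-1,1-2r]}(A) > (1-r)^{1/2} · μ_{[-1,1]}(A). -/

import Mathlib

open MeasureTheory Real Set

/-- The measure `μ_{[a,b]}` of a set `A ⊆ [a,b]`. -/
noncomputable def muInterval (a b : ℝ) (A : Set ℝ) : ℝ :=
  ∫ x in A, ((b - a) / 2) / Real.sqrt (((b - a) / 2) ^ 2 - (x - (a + b) / 2) ^ 2)

/-- The arcsine density on `[m - c, m + c]` is integrable. -/
lemma integrableOn_arcsine_density {c : ℝ} (hc : 0 < c) (m : ℝ) :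
    IntegrableOn (fun x => c / √(c ^ 2 - (x - m) ^ 2)) (Icc (m - c) (m + c)) := by
  rw [integrableOn_Icc_iff_integrableOn_Ioc]
  refine intervalIntegral.integrableOn_deriv_of_nonneg
    (g := fun x => c * arcsin ((x - m) / c)) (by fun_prop) (fun x hx => ?_)
    (fun x _ => by positivity)
  have hlt : (x - m) / c < 1 := by rw [div_lt_one hc]; linarith [hx.2]
  have hgt : -1 < (x - m) / c := by rw [lt_div_iff₀ hc]; linarith [hx.1]
  have hd : HasDerivAt (fun x => (x - m) / c) (1 / c) x :=
    ((hasDerivAt_id x).sub_const m).div_const c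
  refine (((hasDerivAt_arcsin hgt.ne' hlt.ne).comp x hd).const_mul c).congr_deriv ?_
  have hsq : c ^ 2 - (x - m) ^ 2 = c ^ 2 * (1 - ((x - m) / c) ^ 2) := by field_simp
  have hpos : 0 < √(1 - ((x - m) / c) ^ 2) := sqrt_pos.2 (by nlinarith)
  rw [hsq, sqrt_mul (sq_nonneg c), sqrt_sq hc.le]
  field_simp

/-- Pointwise comparison of the arcsine densities of `[-1, 1]` and `[-1, 1 - 2r]`. -/
lemma sqrt_mul_arcsine_density_lt {r x : ℝ} (hr : r ∈ Ioo (0 : ℝ) 1)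
    (hx : x ∈ Ioo (-1 : ℝ) (1 - 2 * r)) :
    √(1 - r) * (1 / √(1 ^ 2 - (x - 0) ^ 2)) <
      (1 - r) / √((1 - r) ^ 2 - (x - -r) ^ 2) := by
  obtain ⟨hr0, hr1⟩ := hr
  obtain ⟨hx0, hx1⟩ := hx
  have hs : 0 < 1 - r := by linarith
  have hP : 0 < (1 : ℝ) ^ 2 - (x - 0) ^ 2 := by nlinarith
  have hQ : 0 < (1 - r) ^ 2 - (x - -r) ^ 2 := by nlinarith
  rw [mul_one_div, div_lt_div_iff₀ (sqrt_pos.2 hP) (sqrt_pos.2 hQ), ← sqrt_mul hs.le]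
  refine (sqrt_lt_sqrt (by positivity)
    (y := (1 - r) ^ 2 * (1 ^ 2 - (x - 0) ^ 2)) ?_).trans_eq ?_
  · have : 0 < (1 - r) * (r * (1 + x) ^ 2) :=
      mul_pos hs (mul_pos hr0 (pow_pos (by linarith) 2))
    linarith
  · rw [sqrt_mul (sq_nonneg _), sqrt_sq hs.le]

/-- Integrals over a set of positive measure preserve almost everywhere strict inequalities. -/
lemma setIntegral_lt_setIntegral_of_ae_lt {α : Type*} [MeasurableSpace α] {μ : Measure α}
    {s : Set α} {f g : α → ℝ} (hf : IntegrableOn f s μ) (hg : IntegrableOn g s μ)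
    (hs : μ s ≠ 0) (hfg : ∀ᵐ x ∂μ.restrict s, f x < g x) :
    ∫ x in s, f x ∂μ < ∫ x in s, g x ∂μ := by
  rw [← sub_pos, ← integral_sub hg hf, integral_pos_iff_support_of_nonneg_ae
    (hfg.mono fun x hx => (sub_pos.2 hx).le) (hg.sub hf)]
  have hsupp : Function.support (fun x => g x - f x) =ᵐ[μ.restrict s] univ :=
    Filter.eventuallyEq_univ.2 (hfg.mono fun x hx => (sub_pos.2 hx).ne')
  rw [measure_congr hsupp, Measure.restrict_apply_univ]
  exact pos_iff_ne_zero.2 hs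

theorem mu_left_subinterval_gt (r : ℝ) (hr : r ∈ Set.Ioo (0 : ℝ) 1) (A : Set ℝ)
    (hA : A ⊆ Set.Icc (-1 : ℝ) (1 - 2 * r)) (hAm : MeasurableSet A) (hA0 : 0 < volume A) :
    Real.sqrt (1 - r) * muInterval (-1) 1 A < muInterval (-1) (1 - 2 * r) A := by
  have h1 : ((1 : ℝ) - -1) / 2 = 1 := by norm_num
  have h2 : ((-1 : ℝ) + 1) / 2 = 0 := by norm_num
  have h3 : (1 - 2 * r - -1) / 2 = 1 - r := by ring
  have h4 : (-1 + (1 - 2 * r)) / 2 = -r := by ring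
  rw [muInterval, muInterval, h1, h2, h3, h4, ← integral_const_mul]
  refine setIntegral_lt_setIntegral_of_ae_lt ?_ ?_ hA0.ne' ?_
  · refine Integrable.const_mul ((integrableOn_arcsine_density one_pos 0).mono_set
      (hA.trans (Icc_subset_Icc ?_ ?_))) _ <;> linarith [hr.1]
  · refine (integrableOn_arcsine_density (sub_pos.2 hr.2) (-r)).mono_set
      (hA.trans (Icc_subset_Icc ?_ ?_)) <;> linarith
  · rw [ae_restrict_iff' hAm]
    filter_upwards [Measure.ae_ne volume (-1 : ℝ), Measure.ae_ne volume (1 - 2 * r)]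
      with x hx0 hx1 hxA
    exact sqrt_mul_arcsine_density_lt hr
      ⟨lt_of_le_of_ne (hA hxA).1 hx0.symm, lt_of_le_of_ne (hA hxA).2 hx1⟩
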